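/- Let M = N and let τ, τ' > 0 be two (possibly different) variance values. With C_c = τ' τ Vᴴ Λᴴ D Λ Λᴴ and C_d = α̃ I_N − τ' Vᴴ Λᴴ D Λ V, where α̃ = (τ'/N) Σ_{i=1}^{N} |λ_i|² / (τ |λ_i|² + σ²), the characteristic polynomial of the block matrix C = [[C_a, C_b], [C_c, C_d]] satisfies, for every η ∈ ℂ, det(η I_{2N} − C) = ∏_{i=1}^{N} [ (η − β_i)( η − α̃ + (τ'/τ) β_i ) + (τ'/τ) β_i² ]. -/

import Mathlib

open Matrix

/-- The determinant of a `2 × 2` block matrix whose four blocks are diagonal. -/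
theorem det_fromBlocks_diagonal {n R : Type*} [Fintype n] [DecidableEq n] [CommRing R]
    (a b c d : n → R) :
    (fromBlocks (diagonal a) (diagonal b) (diagonal c) (diagonal d)).det
      = ∏ i, (a i * d i - b i * c i) := by
  let e : Fin 2 × n ≃ n ⊕ n :=
    (finTwoEquiv.prodCongr (Equiv.refl n)).trans (Equiv.boolProdEquivSum n)
  have h : (fromBlocks (diagonal a) (diagonal b) (diagonal c) (diagonal d)).submatrix e e
      = blockDiagonal fun i => !![a i, b i; c i, d i] := by
    ext ⟨i, k⟩ ⟨j, l⟩
    fin_cases i <;> fin_cases j <;>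
      simp [e, finTwoEquiv, Equiv.boolProdEquivSum, diagonal_apply, blockDiagonal_apply]
  rw [← det_submatrix_equiv_self e, h, det_blockDiagonal]
  simp [det_fin_two]

/-- Conjugating the second block coordinate by an invertible matrix preserves the determinant. -/
theorem det_fromBlocks_conj {m n R : Type*} [Fintype m] [DecidableEq m] [Fintype n]
    [DecidableEq n] [CommRing R] (A : Matrix m m R) (B : Matrix m n R) (C : Matrix n m R)
    (E U W : Matrix n n R) (h : W * U = 1) :
    (fromBlocks A (B * U) (W * C) (W * E * U)).det = (fromBlocks A B C E).det := by
  have hmul : fromBlocks A (B * U) (W * C) (W * E * U)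
      = fromBlocks 1 0 0 W * fromBlocks A B C E * fromBlocks 1 0 0 U := by
    simp [fromBlocks_multiply]
  have hdet : W.det * U.det = 1 := by rw [← det_mul, h, det_one]
  rw [hmul, det_mul, det_mul, det_fromBlocks_zero₂₁, det_fromBlocks_zero₂₁, det_one]
  linear_combination (fromBlocks A B C E).det * hdet

/-- **UT-AMP characteristic polynomial with two variance values, square case.**
With `M = N`, current variance `τ` and updated variance `τ'`, the characteristic polynomial of
the UT-AMP iteration matrix satisfies
`det (η I - C) = ∏ i, [ (η - βᵢ)(η - α̃ + (τ'/τ) βᵢ) + (τ'/τ) βᵢ² ]`. -/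
theorem utamp_charpoly_two_variances (N : ℕ) (hN : 0 < N)
    (Λ V : Matrix (Fin N) (Fin N) ℂ)
    (hΛ : ∀ i j, i ≠ j → Λ i j = 0)
    (hV : Vᴴ * V = 1) (hV' : V * Vᴴ = 1)
    (σ2 τ τ' : ℝ) (hσ2 : 0 < σ2) (hτ : 0 < τ) (hτ' : 0 < τ')
    (D : Matrix (Fin N) (Fin N) ℂ)
    (hD : D = ((τ : ℂ) • (Λ * Λᴴ) + (σ2 : ℂ) • (1 : Matrix (Fin N) (Fin N) ℂ))⁻¹)
    (β : Fin N → ℝ)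
    (hβ : ∀ i, β i = τ * ‖Λ i i‖ ^ 2 / (τ * ‖Λ i i‖ ^ 2 + σ2))
    (α' : ℝ) (hα' : α' = (τ' / N) * ∑ i, ‖Λ i i‖ ^ 2 / (τ * ‖Λ i i‖ ^ 2 + σ2))
    (Cmat : Matrix (Fin N ⊕ Fin N) (Fin N ⊕ Fin N) ℂ)
    (hC : Cmat = fromBlocks
      ((τ : ℂ) • (D * (Λ * Λᴴ)))
      (-(D * (Λ * V)))
      (((τ' : ℂ) * (τ : ℂ)) • (Vᴴ * Λᴴ * (D * (Λ * Λᴴ))))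
      ((α' : ℂ) • (1 : Matrix (Fin N) (Fin N) ℂ) - (τ' : ℂ) • (Vᴴ * Λᴴ * (D * (Λ * V))))) :
    ∀ η : ℂ,
      (η • (1 : Matrix (Fin N ⊕ Fin N) (Fin N ⊕ Fin N) ℂ) - Cmat).det
        = ∏ i : Fin N,
            ((η - ((β i : ℝ) : ℂ)) * (η - (α' : ℂ) + ((τ' / τ : ℝ) : ℂ) * ((β i : ℝ) : ℂ))
              + ((τ' / τ : ℝ) : ℂ) * ((β i : ℝ) : ℂ) ^ 2) := by
  intro η
  obtain ⟨l, rfl⟩ : ∃ l, Λ = diagonal l :=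
    ⟨diag Λ, ((isDiag_iff_diagonal_diag Λ).1 fun i j hij => hΛ i j hij).symm⟩
  have hpos (i : Fin N) : (0 : ℝ) < τ * ‖l i‖ ^ 2 + σ2 := by positivity
  have hne (i : Fin N) : (τ : ℂ) * (‖l i‖ : ℂ) ^ 2 + σ2 ≠ 0 := by exact_mod_cast (hpos i).ne'
  have hτ0 : (τ : ℂ) ≠ 0 := by exact_mod_cast hτ.ne'
  have hnorm (i : Fin N) : l i * star (l i) = (‖l i‖ : ℂ) ^ 2 := Complex.mul_conj' (l i)
  set d : Fin N → ℂ := fun i => ((τ : ℂ) * (‖l i‖ : ℂ) ^ 2 + σ2)⁻¹ with hd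
  have hDd : D = diagonal d := by
    rw [hD]
    apply inv_eq_left_inv
    rw [diagonal_conjTranspose, diagonal_mul_diagonal, ← diagonal_one, ← diagonal_smul,
      ← diagonal_smul, diagonal_add, diagonal_mul_diagonal]
    congr 1
    ext i
    simp only [Pi.smul_apply, Pi.star_apply, smul_eq_mul, mul_one, hnorm, hd]
    exact inv_mul_cancel₀ (hne i)
  have hblocks : η • (1 : Matrix (Fin N ⊕ Fin N) (Fin N ⊕ Fin N) ℂ) - Cmat = fromBlocks
      (diagonal fun i => η - τ * (d i * (l i * star (l i))))
      (diagonal (fun i => d i * l i) * V)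
      (Vᴴ * diagonal fun i => -(τ' * τ * (star (l i) * (d i * (l i * star (l i))))))
      (Vᴴ * (diagonal fun i => η - α' + τ' * (star (l i) * (d i * l i))) * V) := by
    have hconj : (diagonal fun i => η - α' + τ' * (star (l i) * (d i * l i)))
        = (η - α') • (1 : Matrix (Fin N) (Fin N) ℂ)
          + (τ' : ℂ) • ((diagonal l)ᴴ * (diagonal d * diagonal l)) := by
      ext i j
      by_cases h : i = j <;> simp [h]
    rw [hC, hDd, ← fromBlocks_one, fromBlocks_smul, sub_eq_add_neg, fromBlocks_neg,
      fromBlocks_add, hconj]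
    congr 1
    · ext i j
      by_cases h : i = j <;> simp [h, one_apply, sub_eq_add_neg]
    · rw [smul_zero, zero_add, neg_neg, ← Matrix.mul_assoc, diagonal_mul_diagonal]
    · rw [smul_zero, zero_add, Matrix.mul_assoc, ← Matrix.mul_smul, ← Matrix.mul_neg]
      congr 1
      ext i j
      by_cases h : i = j <;> simp [h]
    · rw [Matrix.mul_add, Matrix.add_mul, Matrix.mul_smul, Matrix.mul_one, Matrix.smul_mul, hV,
        Matrix.mul_smul, Matrix.smul_mul, sub_smul]
      simp only [Matrix.mul_assoc]
      abel
  rw [hblocks, det_fromBlocks_conj _ _ _ _ _ _ hV, det_fromBlocks_diagonal]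
  refine Finset.prod_congr rfl fun i _ => ?_
  have hβd : ((β i : ℝ) : ℂ) = τ * d i * (l i * star (l i)) := by
    rw [hβ, hnorm, diagonal_apply_eq, hd]
    push_cast
    rw [div_eq_mul_inv]
    ring
  rw [hβd]
  push_cast
  field_simp
  ring
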